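/- Let D ⊆ ℝ^d and D' ⊆ ℝ^{d'} be domains, let 1 ≤ p1, p2 < ∞, and let G† : L^{p1}(D; ℝ) → L^{p2}(D'; ℝ) be a continuous map. Let σ1 ∈ A^L_0 and σ2, σ3 ∈ A_0. Then for every compact set K ⊆ L^{p1}(D; ℝ) and every 0 < ε ≤ 1 there exist N ∈ ℕ and a neural operator G ∈ NO_N(σ1, σ2, σ3; D, D') such that sup_{a∈K} ‖G†(a) − G(a)‖_{L^{p2}(D')} ≤ ε. -/

import Mathlib

open MeasureTheory Filter
open scoped ENNReal BigOperators

noncomputable section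

/-- `IsNNRep σ n m f` : `f` is of the form `x ↦ W_n σ(… W_1 σ(W_0 x + b_0) + b_1 …) + b_n`
with output dimension `m`. -/
def IsNNRep (σ : ℝ → ℝ) {ι : Type*} [Fintype ι] :
    ℕ → (m : ℕ) → ((ι → ℝ) → (Fin m → ℝ)) → Prop
  | 0, m, f => ∃ (W : Matrix (Fin m) ι ℝ) (b : Fin m → ℝ),
      f = fun x => W.mulVec x + b
  | n + 1, m, f => ∃ (k : ℕ) (g : (ι → ℝ) → (Fin k → ℝ))
      (W : Matrix (Fin m) (Fin k) ℝ) (b : Fin m → ℝ),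
      IsNNRep σ n k g ∧ f = fun x => W.mulVec (fun i => σ (g x i)) + b

/-- `f` is an `n`-layer real-valued `σ`-neural network. -/
def IsNN (σ : ℝ → ℝ) {ι : Type*} [Fintype ι] (n : ℕ) (f : (ι → ℝ) → ℝ) : Prop :=
  ∃ g : (ι → ℝ) → (Fin 1 → ℝ), IsNNRep σ n 1 g ∧ f = fun x => g x 0

/-- vector-valued neural networks, componentwise. -/
def IsNNV (σ : ℝ → ℝ) {ι : Type*} [Fintype ι] (n : ℕ) {m : ℕ}
    (f : (ι → ℝ) → (Fin m → ℝ)) : Prop :=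
  ∀ i : Fin m, IsNN σ n fun x => f x i

/-- matrix-valued neural networks, entrywise. -/
def IsNNM (σ : ℝ → ℝ) {ι : Type*} [Fintype ι] (n : ℕ) {a b : ℕ}
    (f : (ι → ℝ) → Matrix (Fin a) (Fin b) ℝ) : Prop :=
  ∀ (i : Fin a) (j : Fin b), IsNN σ n fun x => f x i j

/-- The class `A_0` of activation functions. -/
def MemA0 (σ : ℝ → ℝ) : Prop :=
  Continuous σ ∧ ∃ n : ℕ, ∀ (k : ℕ) (K : Set (Fin k → ℝ)), IsCompact K →
    ∀ f : (Fin k → ℝ) → ℝ, ContinuousOn f K → ∀ ε : ℝ, 0 < ε →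
      ∃ g : (Fin k → ℝ) → ℝ, IsNN σ n g ∧ ∀ x ∈ K, |f x - g x| ≤ ε

/-- The class `A^L_0` of linearly bounded activation functions. -/
def MemAL0 (σ : ℝ → ℝ) : Prop :=
  MemA0 σ ∧ Measurable σ ∧ ∃ C : ℝ, ∀ x : ℝ, |σ x| ≤ C * (1 + |x|)

/-- The class `BA` of activations admitting bounded approximations to the identity. -/
def MemBA (σ : ℝ → ℝ) : Prop :=
  MemA0 σ ∧ ∀ (k : ℕ) (K : Set (Fin k → ℝ)), IsCompact K →
    ∀ ε : ℝ, 0 < ε → ∀ C : ℝ, 0 ≤ C →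
      (∀ x ∈ K, ∀ y ∈ K, Real.sqrt (∑ i, (x i - y i) ^ 2) ≤ C) →
      ∃ (n : ℕ) (f : (Fin k → ℝ) → (Fin k → ℝ)), IsNNV σ n f ∧
        (∀ x ∈ K, Real.sqrt (∑ i, (f x i - x i) ^ 2) ≤ ε) ∧
        ∀ x, Real.sqrt (∑ i, (f x i) ^ 2) ≤ C

/-- A domain: bounded, connected, open, topologically regular. -/
def IsRegularDomain {k : ℕ} (D : Set (Fin k → ℝ)) : Prop :=
  IsOpen D ∧ IsConnected D ∧ Bornology.IsBounded D ∧ interior (closure D) = D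

/-- affine kernel integral operators `IO(σ; D, ℝ^{d1}, ℝ^{d2})`. -/
def IsIO (σ : ℝ → ℝ) {d : ℕ} (D : Set (Fin d → ℝ)) (d1 d2 : ℕ)
    (S : ((Fin d → ℝ) → (Fin d1 → ℝ)) → ((Fin d → ℝ) → (Fin d2 → ℝ))) : Prop :=
  ∃ (n1 n2 : ℕ) (κ : ((Fin d ⊕ Fin d) → ℝ) → Matrix (Fin d2) (Fin d1) ℝ)
    (b : (Fin d → ℝ) → (Fin d2 → ℝ)),
    IsNNM σ n1 κ ∧ IsNNV σ n2 b ∧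
    S = fun f x => (∫ y in D, (κ (Sum.elim x y)).mulVec (f y)) + b x

/-- The chain `S_{n-1} σ1 (⋯ S_2 σ1 (S_1 (S_0 f)) ⋯)` of `n` integral operators. -/
inductive NOChain (σ1 σ2 : ℝ → ℝ) {d : ℕ} (D : Set (Fin d → ℝ)) (da : ℕ) :
    ℕ → (m : ℕ) → (((Fin d → ℝ) → (Fin da → ℝ)) → ((Fin d → ℝ) → (Fin m → ℝ))) → Prop
  | base {d0 d1 : ℕ}
      {S0 : ((Fin d → ℝ) → (Fin da → ℝ)) → ((Fin d → ℝ) → (Fin d0 → ℝ))}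
      {S1 : ((Fin d → ℝ) → (Fin d0 → ℝ)) → ((Fin d → ℝ) → (Fin d1 → ℝ))}
      (h0 : IsIO σ2 D da d0 S0) (h1 : IsIO σ2 D d0 d1 S1) :
      NOChain σ1 σ2 D da 2 d1 fun f => S1 (S0 f)
  | step {n m m' : ℕ}
      {V : ((Fin d → ℝ) → (Fin da → ℝ)) → ((Fin d → ℝ) → (Fin m → ℝ))}
      {S : ((Fin d → ℝ) → (Fin m → ℝ)) → ((Fin d → ℝ) → (Fin m' → ℝ))}
      (hV : NOChain σ1 σ2 D da n m V) (hS : IsIO σ2 D m m' S) :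
      NOChain σ1 σ2 D da (n + 1) m' fun f => S fun y i => σ1 (V f y i)

/-- `n`-layer neural operators `NO_n(σ1, σ2, σ3; D, D', ℝ^{da}, ℝ^{du})`. -/
def IsNO (σ1 σ2 σ3 : ℝ → ℝ) {d d' : ℕ} (D : Set (Fin d → ℝ)) (D' : Set (Fin d' → ℝ))
    (da du n : ℕ)
    (G : ((Fin d → ℝ) → (Fin da → ℝ)) → ((Fin d' → ℝ) → (Fin du → ℝ))) : Prop :=
  ∃ (m : ℕ) (V : ((Fin d → ℝ) → (Fin da → ℝ)) → ((Fin d → ℝ) → (Fin m → ℝ)))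
    (l : ℕ) (κ : ((Fin d' ⊕ Fin d) → ℝ) → Matrix (Fin du) (Fin m) ℝ),
    NOChain σ1 σ2 D da n m V ∧ IsNNM σ3 l κ ∧
    G = fun f x => ∫ y in D, (κ (Sum.elim x y)).mulVec (V f y)

open Classical in
/-- Extension by zero of a bounded continuous function on a subset. -/
noncomputable def extendZero {α : Type*} [TopologicalSpace α] {s : Set α}
    (u : BoundedContinuousFunction s ℝ) : α → ℝ :=
  fun x => if h : x ∈ s then u ⟨x, h⟩ else 0


theorem norm_sum_smul_sub_sum_smul_le {ι E : Type*} [Fintype ι] [NormedAddCommGroup E]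
    [NormedSpace ℝ E] {φ : ι → E} {b c : ι → ℝ} {ε : ℝ}
    (h : ∀ j, |b j - c j| ≤ ε / (∑ j, ‖φ j‖ + 1)) (hε : 0 ≤ ε) :
    ‖∑ j, b j • φ j - ∑ j, c j • φ j‖ ≤ ε := by
  have hpos : 0 < ∑ j, ‖φ j‖ + 1 := by positivity
  rw [← Finset.sum_sub_distrib]
  calc _ ≤ ∑ j, ε / (∑ j, ‖φ j‖ + 1) * ‖φ j‖ := by
        refine norm_sum_le_of_le _ fun j _ => ?_
        rw [← sub_smul, norm_smul]
        exact mul_le_mul_of_nonneg_right (h j) (norm_nonneg _)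
    _ ≤ ε := by
        rw [← Finset.mul_sum, div_mul_eq_mul_div, div_le_iff₀ hpos]
        gcongr
        linarith

section FiniteRank

variable {X E : Type*} [TopologicalSpace X] [CompactSpace X] [NormedAddCommGroup E]
  [NormedSpace ℝ E]

/-- A continuous map from a compact space to a normed space is uniformly approximated by maps of
finite rank whose directions lie in a prescribed dense set. -/
theorem exists_sum_smul_near_of_dense {F : X → E} (hF : Continuous F) {S : Set E} (hS : Dense S)
    {ε : ℝ} (hε : 0 < ε) :
    ∃ (q : ℕ) (φ : Fin q → E) (ρ : Fin q → C(X, ℝ)), (∀ j, φ j ∈ S) ∧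
      ∀ x, ‖F x - ∑ j, ρ j x • φ j‖ ≤ ε := by
  obtain ⟨t, ht⟩ := isCompact_univ.elim_finite_subcover
    (fun s : S => {x | ‖F x - s‖ < ε}) (fun s => isOpen_lt (by fun_prop) continuous_const)
    (fun x _ => by
      obtain ⟨s, hs, h⟩ := hS.exists_dist_lt (F x) hε
      exact Set.mem_iUnion.2 ⟨⟨s, hs⟩, by simpa [dist_eq_norm] using h⟩)
  let e := t.equivFin.symm
  let φ : Fin t.card → E := fun j => (e j : S)
  let h : Fin t.card → X → ℝ := fun j x => max 0 (ε - ‖F x - φ j‖)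
  have h_nonneg : ∀ j x, 0 ≤ h j x := fun j x => le_max_left _ _
  have h_cont : ∀ j, Continuous (h j) := fun j => by fun_prop
  have h_pos : ∀ x, 0 < ∑ i, h i x := by
    intro x
    obtain ⟨s, hs, hx⟩ : ∃ s ∈ t, ‖F x - s‖ < ε := by
      simpa using ht (Set.mem_univ x)
    refine Finset.sum_pos' (fun i _ => h_nonneg i x) ⟨e.symm ⟨s, hs⟩, Finset.mem_univ _, ?_⟩
    simp [h, φ, hx]
  refine ⟨t.card, φ, fun j => ⟨fun x => h j x / ∑ i, h i x,
    (h_cont j).div (by fun_prop) fun x => (h_pos x).ne'⟩, fun j => (e j : S).2, fun x => ?_⟩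
  have hsum : ∑ j, h j x / ∑ i, h i x = 1 := by
    rw [← Finset.sum_div, div_self (h_pos x).ne']
  have hrw : F x - ∑ j, (h j x / ∑ i, h i x) • φ j
      = ∑ j, (h j x / ∑ i, h i x) • (F x - φ j) := by
    simp_rw [smul_sub, Finset.sum_sub_distrib, ← Finset.sum_smul, hsum, one_smul]
  change ‖F x - ∑ j, (h j x / ∑ i, h i x) • φ j‖ ≤ ε
  rw [hrw]
  calc _ ≤ ∑ j, (h j x / ∑ i, h i x) * ε := by
        refine norm_sum_le_of_le _ fun j _ => ?_
        have hc : 0 ≤ h j x / ∑ i, h i x := div_nonneg (h_nonneg j x) (h_pos x).le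
        rw [norm_smul, Real.norm_of_nonneg hc]
        rcases le_or_gt ‖F x - φ j‖ ε with hj | hj
        · gcongr
        · have : h j x = 0 := max_eq_left (by linarith)
          simp [this]
    _ = ε := by rw [← Finset.sum_mul, hsum, one_mul]

/-- Stone–Weierstrass for finitely many functions at once: continuous functions on a compact space
factor approximately through finitely many members of a point-separating family. -/
theorem exists_continuous_comp_near_of_separates {W : Type*} (ℓ : W → C(X, ℝ))
    (hsep : ∀ x y, x ≠ y → ∃ w, ℓ w x ≠ ℓ w y) {q : ℕ} (ρ : Fin q → C(X, ℝ)) {ε : ℝ}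
    (hε : 0 < ε) :
    ∃ (m : ℕ) (w : Fin m → W) (g : (Fin m → ℝ) → Fin q → ℝ), Continuous g ∧
      ∀ x j, |ρ j x - g (fun i => ℓ (w i) x) j| ≤ ε := by
  classical
  have hA : (Algebra.adjoin ℝ (Set.range ℓ)).SeparatesPoints := by
    intro x y hxy
    obtain ⟨w, hw⟩ := hsep x y hxy
    exact ⟨ℓ w, ⟨ℓ w, Algebra.subset_adjoin ⟨w, rfl⟩, rfl⟩, hw⟩
  have key : ∀ j, ∃ p : MvPolynomial W ℝ, ∀ x,
      |ρ j x - MvPolynomial.eval (fun w => ℓ w x) p| ≤ ε := by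
    intro j
    obtain ⟨⟨f, hf⟩, hfε⟩ :=
      ContinuousMap.exists_mem_subalgebra_near_continuous_of_separatesPoints _ hA (ρ j)
        (ρ j).continuous ε hε
    rw [Algebra.adjoin_range_eq_range_aeval] at hf
    obtain ⟨p, rfl⟩ := hf
    refine ⟨p, fun x => ?_⟩
    have hx : MvPolynomial.aeval ℓ p x = MvPolynomial.eval (fun w => ℓ w x) p := by
      have := MvPolynomial.comp_aeval_apply (R := ℝ) ℓ (ContinuousMap.evalAlgHom ℝ ℝ x) p
      simpa [MvPolynomial.aeval_eq_eval] using this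
    rw [← hx, abs_sub_comm]
    exact (hfε x).le
  choose p hp using key
  let s : Finset W := Finset.univ.biUnion fun j => (p j).vars
  let e := s.equivFin
  refine ⟨s.card, fun i => (e.symm i : W), fun v j => MvPolynomial.eval
    (fun w => if h : w ∈ s then v (e ⟨w, h⟩) else 0) (p j), ?_, fun x j => ?_⟩
  · refine continuous_pi fun j => (MvPolynomial.continuous_eval (p j)).comp ?_
    refine continuous_pi fun w => ?_
    by_cases h : w ∈ s <;> simp only [h, dite_true, dite_false] <;> fun_prop
  · convert hp j x using 3
    refine MvPolynomial.eval₂Hom_congr' rfl (fun w hw _ => ?_) rfl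
    have : w ∈ s := Finset.mem_biUnion.2 ⟨j, Finset.mem_univ _, hw⟩
    simp [this]

theorem exists_sum_comp_smul_near {W : Type*} (ℓ : W → C(X, ℝ))
    (hsep : ∀ x y, x ≠ y → ∃ w, ℓ w x ≠ ℓ w y) {F : X → E} (hF : Continuous F) {S : Set E}
    (hS : Dense S) {ε : ℝ} (hε : 0 < ε) :
    ∃ (m q : ℕ) (w : Fin m → W) (φ : Fin q → E) (g : (Fin m → ℝ) → Fin q → ℝ),
      (∀ j, φ j ∈ S) ∧ Continuous g ∧
      ∀ x, ‖F x - ∑ j, g (fun i => ℓ (w i) x) j • φ j‖ ≤ ε := by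
  obtain ⟨q, φ, ρ, hφ, hρ⟩ := exists_sum_smul_near_of_dense hF hS (half_pos hε)
  have hpos : 0 < ∑ j, ‖φ j‖ + 1 := by positivity
  obtain ⟨m, w, g, hg, hgρ⟩ := exists_continuous_comp_near_of_separates ℓ hsep ρ
    (div_pos (half_pos hε) hpos)
  refine ⟨m, q, w, φ, g, hφ, hg, fun x => ?_⟩
  refine (norm_sub_le_norm_sub_add_norm_sub _ (∑ j, ρ j x • φ j) _).trans ?_
  rw [← add_halves ε]
  refine add_le_add (hρ x) ?_
  exact norm_sum_smul_sub_sum_smul_le (hgρ x) (half_pos hε).le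

end FiniteRank

section Network

variable {σ : ℝ → ℝ} {ι κ : Type*} [Fintype ι] [Fintype κ]

theorem IsNNRep.continuous (hσ : Continuous σ) {n m : ℕ} {f : (ι → ℝ) → Fin m → ℝ}
    (hf : IsNNRep σ n m f) : Continuous f := by
  induction n generalizing m with
  | zero =>
    obtain ⟨W, b, rfl⟩ := hf
    fun_prop
  | succ n ih =>
    obtain ⟨k, g, W, b, hg, rfl⟩ := hf
    have := ih hg
    fun_prop

theorem IsNN.continuous (hσ : Continuous σ) {n : ℕ} {f : (ι → ℝ) → ℝ} (hf : IsNN σ n f) :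
    Continuous f := by
  obtain ⟨g, hg, rfl⟩ := hf
  exact (continuous_apply 0).comp (hg.continuous hσ)

theorem IsNNRep.comp_reindex [DecidableEq ι] (e : ι → κ) {n m : ℕ} {f : (ι → ℝ) → Fin m → ℝ}
    (hf : IsNNRep σ n m f) : IsNNRep σ n m fun x : κ → ℝ => f (x ∘ e) := by
  classical
  induction n generalizing m with
  | zero =>
    obtain ⟨W, b, rfl⟩ := hf
    refine ⟨W * (1 : Matrix κ κ ℝ).submatrix e id, b, ?_⟩
    funext x
    rw [← Matrix.mulVec_mulVec]
    congr 2
    funext i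
    simp [Matrix.mulVec, dotProduct, Matrix.one_apply]
  | succ n ih =>
    obtain ⟨k, g, W, b, hg, rfl⟩ := hf
    exact ⟨k, _, W, b, ih hg, rfl⟩

theorem IsNN.comp_reindex (e : ι → κ) {n : ℕ} {f : (ι → ℝ) → ℝ} (hf : IsNN σ n f) :
    IsNN σ n fun x : κ → ℝ => f (x ∘ e) := by
  classical
  obtain ⟨g, hg, rfl⟩ := hf
  exact ⟨_, hg.comp_reindex e, rfl⟩

theorem isNN_const (σ : ℝ → ℝ) (c : ℝ) : IsNN σ 0 fun _ : ι → ℝ => c :=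
  ⟨fun _ _ => c, ⟨0, fun _ => c, by simp⟩, rfl⟩

/-- Networks of equal depth can be run in parallel. -/
theorem exists_isNNRep_sigma {J : Type*} [Fintype J] {n : ℕ} (m : J → ℕ)
    (f : ∀ j, (ι → ℝ) → Fin (m j) → ℝ) (hf : ∀ j, IsNNRep σ n (m j) (f j)) :
    ∃ (k : ℕ) (g : (ι → ℝ) → Fin k → ℝ) (e : (Σ j, Fin (m j)) ≃ Fin k), IsNNRep σ n k g ∧
      ∀ x s, g x (e s) = f s.1 x s.2 := by
  classical
  induction n generalizing m with
  | zero =>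
    choose W b hW using hf
    let e := Fintype.equivFin (Σ j, Fin (m j))
    let A : (Σ j, Fin (m j)) → ι → ℝ := fun s => W s.1 s.2
    let c : (Σ j, Fin (m j)) → ℝ := fun s => b s.1 s.2
    refine ⟨_, _, e, ⟨fun i => A (e.symm i), fun i => c (e.symm i), rfl⟩, fun x s => ?_⟩
    simp only [hW, Matrix.mulVec, Pi.add_apply, Equiv.symm_apply_apply]
    rfl
  | succ n ih =>
    choose k g W b hg hW using hf
    obtain ⟨K, G, e', hG, hGe⟩ := ih k g hg
    let e := Fintype.equivFin (Σ j, Fin (m j))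
    let A : (Σ j, Fin (m j)) → (Σ j, Fin (k j)) → ℝ := fun s t =>
      if h : t.1 = s.1 then W s.1 s.2 (h ▸ t.2) else 0
    let c : (Σ j, Fin (m j)) → ℝ := fun s => b s.1 s.2
    refine ⟨_, _, e, ⟨K, G, fun i l => A (e.symm i) (e'.symm l), fun i => c (e.symm i), hG, rfl⟩,
      fun x s => ?_⟩
    simp only [hW, Matrix.mulVec, dotProduct, Pi.add_apply, Equiv.symm_apply_apply]
    refine congrArg (· + c s) ?_
    rw [← e'.sum_comp, Fintype.sum_sigma, Finset.sum_eq_single s.1]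
    · simp [hGe, A]
    · intro j _ hj
      simp [hj, A]
    · simp

theorem IsNNRep.reindex_output {n m q : ℕ} {f : (ι → ℝ) → Fin m → ℝ} (hf : IsNNRep σ n m f)
    (r : Fin q → Fin m) : IsNNRep σ n q fun x => f x ∘ r := by
  cases n with
  | zero =>
    obtain ⟨W, b, rfl⟩ := hf
    exact ⟨W.submatrix r id, b ∘ r, rfl⟩
  | succ n =>
    obtain ⟨k, g, W, b, hg, rfl⟩ := hf
    exact ⟨k, g, W.submatrix r id, b ∘ r, hg, rfl⟩

theorem isNNRep_pi {q n : ℕ} {f : Fin q → (ι → ℝ) → ℝ} (hf : ∀ j, IsNN σ n (f j)) :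
    IsNNRep σ n q fun x j => f j x := by
  choose g hg hfg using hf
  obtain ⟨k, G, e, hG, hGe⟩ := exists_isNNRep_sigma (fun _ => 1) g hg
  convert hG.reindex_output fun j => e ⟨j, 0⟩ using 3 with x j
  simp [hGe, hfg]

end Network

section Chain

variable {d da m : ℕ} {D : Set (Fin d → ℝ)} {σ1 σ2 : ℝ → ℝ}

/-- On constant functions, an affine map is an integral operator with constant kernel. -/
theorem exists_isIO_of_affine (hD : volume.real D ≠ 0) {k : ℕ} (W : Matrix (Fin k) (Fin m) ℝ)
    (b : Fin k → ℝ) : ∃ S, IsIO σ2 D m k S ∧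
      ∀ v : Fin m → ℝ, S (fun _ => v) = fun _ => W.mulVec v + b := by
  refine ⟨_, ⟨0, 0, fun _ => (volume.real D)⁻¹ • W, fun _ => b, fun i j => isNN_const _ _,
    fun i => isNN_const _ _, rfl⟩, fun v => ?_⟩
  funext x
  rw [setIntegral_const, Matrix.smul_mulVec, smul_smul, mul_inv_cancel₀ hD, one_smul]

/-- A network applied to finitely many integral functionals is a chain of integral operators. -/
theorem exists_noChain_of_isNNRep (hD : volume.real D ≠ 0)
    {S0 : ((Fin d → ℝ) → Fin da → ℝ) → (Fin d → ℝ) → Fin m → ℝ} (hS0 : IsIO σ2 D da m S0)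
    {L : ((Fin d → ℝ) → Fin da → ℝ) → Fin m → ℝ} (hL : ∀ f, S0 f = fun _ => L f)
    {n k : ℕ} {g : (Fin m → ℝ) → Fin k → ℝ} (hg : IsNNRep σ1 n k g) :
    ∃ V, NOChain σ1 σ2 D da (n + 2) k V ∧ ∀ f, V f = fun _ => g (L f) := by
  induction n generalizing k with
  | zero =>
    obtain ⟨W, b, rfl⟩ := hg
    obtain ⟨S, hS, hSv⟩ := exists_isIO_of_affine (σ2 := σ2) hD W b
    exact ⟨_, .base hS0 hS, fun f => by rw [hL, hSv]⟩
  | succ n ih =>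
    obtain ⟨l, h, W, b, hh, rfl⟩ := hg
    obtain ⟨V, hV, hVf⟩ := ih hh
    obtain ⟨S, hS, hSv⟩ := exists_isIO_of_affine (σ2 := σ2) hD W b
    exact ⟨_, .step hV hS, fun f => by rw [hVf, hSv]⟩

end Chain

section Lebesgue

variable {k n : ℕ} {D : Set (Fin k → ℝ)} {σ : ℝ → ℝ} {p : ℝ≥0∞}

theorem IsNN.memLp (hD : Bornology.IsBounded D) (hDm : MeasurableSet D) (hσ : Continuous σ)
    {f : (Fin k → ℝ) → ℝ} (hf : IsNN σ n f) : MemLp f p (volume.restrict D) := by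
  have : IsFiniteMeasure (volume.restrict D) := ⟨by simpa using hD.measure_lt_top⟩
  have hc := hf.continuous hσ
  obtain ⟨C, hC⟩ := hD.isCompact_closure.exists_bound_of_continuousOn hc.continuousOn
  exact MemLp.of_bound hc.aestronglyMeasurable C
    ((ae_restrict_mem hDm).mono fun x hx => hC x (subset_closure hx))

theorem dense_toLp_isNN [Fact (1 ≤ p)] (hp : p ≠ ∞) (hD : Bornology.IsBounded D)
    (hDm : MeasurableSet D) (hσ : Continuous σ)
    (hn : ∀ K : Set (Fin k → ℝ), IsCompact K → ∀ f : (Fin k → ℝ) → ℝ, ContinuousOn f K →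
      ∀ ε : ℝ, 0 < ε → ∃ g : (Fin k → ℝ) → ℝ, IsNN σ n g ∧ ∀ x ∈ K, |f x - g x| ≤ ε) :
    Dense {u : Lp ℝ p (volume.restrict D) | ∃ (f : (Fin k → ℝ) → ℝ) (hf : IsNN σ n f),
      u = (hf.memLp hD hDm hσ).toLp f} := by
  have : IsFiniteMeasure (volume.restrict D) := ⟨by simpa using hD.measure_lt_top⟩
  intro u
  rw [Metric.mem_closure_iff]
  intro ε hε
  obtain ⟨g, hg, hgm⟩ := (Lp.memLp u).exists_boundedContinuous_eLpNorm_sub_le hp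
    (ENNReal.ofReal_pos.2 (div_pos hε three_pos)).ne'
  set M := (volume.restrict D) Set.univ ^ p.toReal⁻¹ with hM
  have hMtop : M ≠ ∞ := ENNReal.rpow_ne_top_of_nonneg (by positivity) (measure_ne_top _ _)
  obtain ⟨f, hf, hfg⟩ := hn _ hD.isCompact_closure g g.continuous.continuousOn
    (ε / 3 / (M.toReal + 1)) (by positivity)
  refine ⟨_, ⟨f, hf, rfl⟩, ?_⟩
  have hgf : eLpNorm (⇑g - f) p (volume.restrict D) ≤ ENNReal.ofReal (ε / 3) := by
    refine (eLpNorm_le_of_ae_bound ((ae_restrict_mem hDm).mono fun x hx =>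
      hfg x (subset_closure hx))).trans ?_
    rw [← hM, ← ENNReal.ofReal_toReal hMtop, ← ENNReal.ofReal_mul ENNReal.toReal_nonneg,
      ENNReal.toReal_ofReal ENNReal.toReal_nonneg]
    refine ENNReal.ofReal_le_ofReal ?_
    rw [mul_div_assoc', div_le_iff₀ (by positivity), mul_comm]
    gcongr
    linarith
  have h1 : dist u (hgm.toLp g) ≤ ε / 3 := by
    rw [dist_edist, Lp.edist_def]
    refine ENNReal.toReal_le_of_le_ofReal (by positivity) ((eLpNorm_congr_ae ?_).trans_le hg)
    exact (Filter.EventuallyEq.refl _ _).sub hgm.coeFn_toLp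
  have h2 : dist (hgm.toLp g) ((hf.memLp hD hDm hσ).toLp f) ≤ ε / 3 := by
    rw [dist_edist, Lp.edist_toLp_toLp]
    exact ENNReal.toReal_le_of_le_ofReal (by positivity) hgf
  linarith [dist_triangle u (hgm.toLp g) ((hf.memLp hD hDm hσ).toLp f)]

theorem integrable_isNN_mul [Fact (1 ≤ p)] (hD : Bornology.IsBounded D)
    (hDm : MeasurableSet D) (hσ : Continuous σ) {w : (Fin k → ℝ) → ℝ} (hw : IsNN σ n w)
    (a : Lp ℝ p (volume.restrict D)) :
    Integrable (fun y => w y * a y) (volume.restrict D) := by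
  have := ENNReal.HolderConjugate.conjExponent (Fact.out : 1 ≤ p)
  exact (hw.memLp (p := p.conjExponent) hD hDm hσ).integrable_mul (Lp.memLp a)

theorem continuous_integral_isNN_mul [Fact (1 ≤ p)] (hD : Bornology.IsBounded D)
    (hDm : MeasurableSet D) (hσ : Continuous σ) {w : (Fin k → ℝ) → ℝ} (hw : IsNN σ n w) :
    Continuous fun a : Lp ℝ p (volume.restrict D) => ∫ y in D, w y * a y := by
  have := ENNReal.HolderConjugate.conjExponent (Fact.out : 1 ≤ p)
  have : Fact (1 ≤ p.conjExponent) := ⟨ENNReal.HolderConjugate.one_le _ p⟩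
  have hwL : MemLp w p.conjExponent (volume.restrict D) := hw.memLp hD hDm hσ
  convert (((ContinuousLinearMap.mul ℝ ℝ).lpPairing (volume.restrict D) p.conjExponent p)
    (hwL.toLp w)).continuous using 2 with a
  rw [ContinuousLinearMap.lpPairing_eq_integral]
  refine integral_congr_ae (hwL.coeFn_toLp.mono fun y hy => ?_)
  simp [hy]

/-- Integration against networks separates the points of `Lp`. -/
theorem exists_integral_isNN_mul_ne [Fact (1 ≤ p)] (hD : Bornology.IsBounded D)
    (hDo : IsOpen D) (hσ : Continuous σ)
    (hn : ∀ K : Set (Fin k → ℝ), IsCompact K → ∀ f : (Fin k → ℝ) → ℝ, ContinuousOn f K →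
      ∀ ε : ℝ, 0 < ε → ∃ g : (Fin k → ℝ) → ℝ, IsNN σ n g ∧ ∀ x ∈ K, |f x - g x| ≤ ε)
    {a b : Lp ℝ p (volume.restrict D)} (hab : a ≠ b) :
    ∃ w, IsNN σ n w ∧ ∫ y in D, w y * a y ≠ ∫ y in D, w y * b y := by
  have hfin : IsFiniteMeasure (volume.restrict D) := ⟨by simpa using hD.measure_lt_top⟩
  have hDm := hDo.measurableSet
  by_contra! h
  refine hab (sub_eq_zero.1 ?_)
  set c := a - b with hc
  have hcw : ∀ w, IsNN σ n w → ∫ y in D, w y * c y = 0 := by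
    intro w hw
    have : ∫ y in D, w y * c y = ∫ y in D, (w y * a y - w y * b y) :=
      integral_congr_ae ((Lp.coeFn_sub a b).mono fun y hy => by
        simp only [hc, hy, Pi.sub_apply, mul_sub])
    rw [this, integral_sub (integrable_isNN_mul hD hDm hσ hw a)
      (integrable_isNN_mul hD hDm hσ hw b), h w hw, sub_self]
  have hci : Integrable c (volume.restrict D) := (Lp.memLp c).integrable Fact.out
  have key : ∀ f : (Fin k → ℝ) → ℝ, Continuous f → ∫ y in D, f y * c y = 0 := by
    intro f hf
    rw [← abs_eq_zero]
    refine le_antisymm (le_of_forall_pos_le_add fun δ hδ => ?_) (abs_nonneg _)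
    have hI : 0 ≤ ∫ y in D, |c y| := integral_nonneg fun _ => abs_nonneg _
    obtain ⟨w, hw, hwf⟩ := hn _ hD.isCompact_closure f hf.continuousOn
      (δ / ((∫ y in D, |c y|) + 1)) (by positivity)
    obtain ⟨C, hC⟩ := hD.isCompact_closure.exists_bound_of_continuousOn hf.continuousOn
    have hfi : Integrable (fun y => f y * c y) (volume.restrict D) :=
      hci.bdd_mul hf.aestronglyMeasurable
        ((ae_restrict_mem hDm).mono fun x hx => hC x (subset_closure hx))
    have : ∫ y in D, f y * c y = ∫ y in D, (f y * c y - w y * c y) := by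
      rw [integral_sub hfi (integrable_isNN_mul hD hDm hσ hw c), hcw w hw, sub_zero]
    rw [this, zero_add]
    calc |∫ y in D, (f y * c y - w y * c y)|
      _ ≤ ∫ y in D, δ / ((∫ y in D, |c y|) + 1) * |c y| := by
          rw [← Real.norm_eq_abs]
          refine norm_integral_le_of_norm_le (hci.abs.const_mul _)
            ((ae_restrict_mem hDm).mono fun y hy => ?_)
          rw [← sub_mul, norm_mul]
          exact mul_le_mul_of_nonneg_right (hwf y (subset_closure hy)) (abs_nonneg _)
      _ ≤ δ := by
          rw [integral_const_mul, div_mul_eq_mul_div, div_le_iff₀ (by positivity)]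
          gcongr
          linarith
  have hzero := hDo.ae_eq_zero_of_integral_contDiff_smul_eq_zero (f := c)
    (μ := volume.restrict D) (hci.locallyIntegrable.locallyIntegrableOn D)
    fun g hg _ _ => key g hg.continuous
  refine (Lp.eq_zero_iff_ae_eq_zero).2 ?_
  filter_upwards [hzero, ae_restrict_mem hDm] with x hx hxD using hx hxD

end Lebesgue

/-- Universal approximation of continuous operators `L^{p1}(D; ℝ) → L^{p2}(D'; ℝ)`
by neural operators, uniformly over compact sets (Theorem 11, `L^p` case). -/
theorem neural_operator_universal_approximation_Lp
    (d d' : ℕ) (D : Set (Fin d → ℝ)) (D' : Set (Fin d' → ℝ))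
    (hD : IsRegularDomain D) (hD' : IsRegularDomain D')
    (p1 p2 : ℝ≥0∞) [Fact (1 ≤ p1)] [Fact (1 ≤ p2)] (hp1 : p1 ≠ ∞) (hp2 : p2 ≠ ∞)
    (Gdag : Lp ℝ p1 ((volume : Measure (Fin d → ℝ)).restrict D) →
      Lp ℝ p2 ((volume : Measure (Fin d' → ℝ)).restrict D'))
    (hGdag : Continuous Gdag)
    (σ1 σ2 σ3 : ℝ → ℝ) (hσ1 : MemAL0 σ1) (hσ2 : MemA0 σ2) (hσ3 : MemA0 σ3)
    (K : Set (Lp ℝ p1 ((volume : Measure (Fin d → ℝ)).restrict D))) (hK : IsCompact K)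
    (ε : ℝ) (hε0 : 0 < ε) (hε1 : ε ≤ 1) :
    ∃ (N : ℕ) (G : ((Fin d → ℝ) → (Fin 1 → ℝ)) → ((Fin d' → ℝ) → (Fin 1 → ℝ))),
      IsNO σ1 σ2 σ3 D D' 1 1 N G ∧
      ∀ a ∈ K,
        eLpNorm (fun x => Gdag a x - G (fun y _ => a y) x 0)
          p2 ((volume : Measure (Fin d' → ℝ)).restrict D') ≤ ENNReal.ofReal ε := by
  have hDm := hD.1.measurableSet
  have hDm' := hD'.1.measurableSet
  have hDb := hD.2.2.1
  have hDb' := hD'.2.2.1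
  obtain ⟨⟨hc1, n1, hn1⟩, -⟩ := hσ1
  obtain ⟨hc2, n2, hn2⟩ := hσ2
  obtain ⟨hc3, n3, hn3⟩ := hσ3
  have hvol : volume.real D ≠ 0 :=
    (ENNReal.toReal_pos (hD.1.measure_pos volume hD.2.1.nonempty).ne' hDb.measure_lt_top.ne).ne'
  have : CompactSpace K := isCompact_iff_compactSpace.1 hK
  let ℓ : {w : (Fin d → ℝ) → ℝ // IsNN σ2 n2 w} → C(K, ℝ) := fun w =>
    ⟨fun a => ∫ y in D, w.1 y * a.1 y,
      (continuous_integral_isNN_mul hDb hDm hc2 w.2).comp continuous_subtype_val⟩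
  obtain ⟨m, q, w, φ, g, hφ, hg, happrox⟩ := exists_sum_comp_smul_near ℓ
    (fun a b hab => by
      obtain ⟨w, hw, hne⟩ := exists_integral_isNN_mul_ne hDb hD.1 hc2 (hn2 d)
        (Subtype.coe_injective.ne hab)
      exact ⟨⟨w, hw⟩, hne⟩)
    (hGdag.comp continuous_subtype_val) (dense_toLp_isNN hp2 hDb' hDm' hc3 (hn3 d'))
    (half_pos hε0)
  choose f hf hφf using hφ
  let Λ : K → Fin m → ℝ := fun a i => ℓ (w i) a
  have hΛ : Continuous Λ := continuous_pi fun i => (ℓ (w i)).continuous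
  have hpos : 0 < ∑ j, ‖φ j‖ + 1 := by positivity
  have hδ : 0 < |(volume.real D)⁻¹| * (ε / 2 / (∑ j, ‖φ j‖ + 1)) := by positivity
  choose N hN hNg using fun j => hn1 m _ (isCompact_range hΛ)
    (fun v => (volume.real D)⁻¹ * g v j) (by fun_prop) _ hδ
  obtain ⟨V, hV, hVf⟩ := exists_noChain_of_isNNRep (σ2 := σ2) (da := 1) hvol
    ⟨n2, 0, fun z => Matrix.of fun i _ => (w i).1 (z ∘ Sum.inr), fun _ => 0,
      fun i j => (w i).2.comp_reindex _, fun i => isNN_const _ _, rfl⟩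
    (L := fun u => ∫ y in D, (Matrix.of fun i _ => (w i).1 y).mulVec (u y))
    (fun u => by funext x; simp [Function.comp_def]) (isNNRep_pi hN)
  refine ⟨_, _, ⟨q, V, n3, fun z => Matrix.of fun _ j => f j (z ∘ Sum.inl), hV,
    fun _ j => (hf j).comp_reindex _, rfl⟩, fun a ha => ?_⟩
  have hL : ∫ y in D, (Matrix.of fun i _ => (w i).1 y).mulVec (fun _ : Fin 1 => a y)
      = Λ ⟨a, ha⟩ := by
    funext i
    rw [eval_integral]
    · simp [Matrix.mulVec, dotProduct, Λ, ℓ]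
    · intro i
      simpa [Matrix.mulVec, dotProduct] using integrable_isNN_mul hDb hDm hc2 (w i).2 a
  let c : Fin q → ℝ := fun j => volume.real D * N j (Λ ⟨a, ha⟩)
  have hout : ∀ x, (∫ y in D, (Matrix.of fun (_ : Fin 1) j => f j (Sum.elim x y ∘ Sum.inl)).mulVec
      (V (fun y _ => a y) y)) 0 = ∑ j, c j * f j x := by
    intro x
    simp only [hVf, hL, Sum.elim_comp_inl, setIntegral_const]
    simp only [Pi.smul_apply, Matrix.mulVec, dotProduct, Matrix.of_apply, smul_eq_mul,
      Finset.mul_sum, c]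
    exact Finset.sum_congr rfl fun j _ => by ring
  have hae : (fun x => Gdag a x - ∑ j, c j * f j x) =ᵐ[volume.restrict D']
      (Gdag a - ∑ j, c j • φ j : Lp ℝ p2 (volume.restrict D')) := by
    have h1 : ∀ᵐ x ∂volume.restrict D', ∀ j, (c j • φ j : Lp ℝ p2 (volume.restrict D')) x
        = c j * f j x := by
      refine ae_all_iff.2 fun j => ?_
      have h2 := ((hf j).memLp hDb' hDm' hc3 (p := p2)).coeFn_toLp
      rw [← hφf j] at h2
      filter_upwards [Lp.coeFn_smul (c j) (φ j), h2] with x hx hx2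
      rw [hx, Pi.smul_apply, hx2, smul_eq_mul]
    filter_upwards [Lp.coeFn_sub (Gdag a) (∑ j, c j • φ j),
      Lp.coeFn_finsetSum Finset.univ fun j => c j • φ j, h1] with x hx hx1 hx2
    rw [hx, Pi.sub_apply, hx1, Finset.sum_apply]
    simp_rw [hx2]
  simp only [hout]
  rw [eLpNorm_congr_ae hae, ← Lp.enorm_def, ← ofReal_norm]
  refine ENNReal.ofReal_le_ofReal ?_
  have hcg : ∀ j, |g (Λ ⟨a, ha⟩) j - c j| ≤ ε / 2 / (∑ j, ‖φ j‖ + 1) := by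
    intro j
    have h := hNg j _ ⟨⟨a, ha⟩, rfl⟩
    have hfac : (volume.real D)⁻¹ * g (Λ ⟨a, ha⟩) j - N j (Λ ⟨a, ha⟩)
        = (volume.real D)⁻¹ * (g (Λ ⟨a, ha⟩) j - c j) := by
      simp only [c]
      field_simp
    rw [hfac, abs_mul] at h
    exact le_of_mul_le_mul_left h (by positivity)
  refine (norm_sub_le_norm_sub_add_norm_sub _ (∑ j, g (Λ ⟨a, ha⟩) j • φ j) _).trans ?_
  rw [← add_halves ε]
  refine add_le_add (happrox ⟨a, ha⟩) ?_
  exact norm_sum_smul_sub_sum_smul_le hcg (half_pos hε0).le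

end
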